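/- Let f : ℝ → ℂ be measurable with (i) ∫_ℝ |f(x)|^p e^{(p/4s)x²}/(1+|x|)^k dx < ∞ and (ii) ∫_ℝ |f̂(λ)|^q e^{qsλ²}/(1+|λ|)^l dλ < ∞, for some p, q ∈ [1,∞), s > 0, k > 1 and l > 1. Then f̂(λ) = P(λ)e^{-sλ²} for a polynomial P with deg P ≤ min{k/p + 1, (l−1)/q} (interpreting the bound as strict where stated); in particular if l ≤ q + 1 then f̂(λ) = c·e^{-sλ²} and f is a constant multiple of e^{-x²/4s}. -/

import Mathlib

open Complex Real MeasureTheory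

/-- A weighted Gaussian `(1 + |x|) ^ α * exp (-x² / 4s)`, tilted by `exp (v x)`, is a shifted
Gaussian up to the factor `exp (s v²) * (1 + 2s|v|) ^ α`. -/
lemma one_add_abs_rpow_mul_exp_le {s α : ℝ} (hs : 0 < s) (hα : 0 ≤ α) (v x : ℝ) :
    (1 + |x|) ^ α * Real.exp (-(x ^ 2 / (4 * s)) + v * x) ≤
      Real.exp (s * v ^ 2) * (1 + 2 * s * |v|) ^ α *
        (Real.exp (2 * s * α ^ 2) * Real.exp (-(8 * s)⁻¹ * (x - 2 * s * v) ^ 2)) := by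
  set y := x - 2 * s * v with hy
  have hxy : 1 + |x| ≤ (1 + 2 * s * |v|) * (1 + |y|) := by
    have h : |x| ≤ |y| + |2 * s * v| := by
      simpa [hy] using abs_add_le y (2 * s * v)
    rw [abs_mul, abs_of_pos (by positivity : 0 < 2 * s)] at h
    have : 0 ≤ 2 * s * |v| * |y| := by positivity
    linarith
  have hpow : (1 + |x|) ^ α ≤ (1 + 2 * s * |v|) ^ α * Real.exp (α * |y|) := by
    calc (1 + |x|) ^ α ≤ ((1 + 2 * s * |v|) * (1 + |y|)) ^ α := by gcongr
      _ = (1 + 2 * s * |v|) ^ α * (1 + |y|) ^ α := Real.mul_rpow (by positivity) (by positivity)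
      _ ≤ (1 + 2 * s * |v|) ^ α * Real.exp |y| ^ α := by
          gcongr
          linarith [Real.add_one_le_exp |y|]
      _ = _ := by rw [← Real.exp_mul, mul_comm α]
  have hexp : α * |y| + (-(x ^ 2 / (4 * s)) + v * x) ≤
      s * v ^ 2 + (2 * s * α ^ 2 + -(8 * s)⁻¹ * y ^ 2) := by
    have h1 : -(x ^ 2 / (4 * s)) + v * x = s * v ^ 2 - y ^ 2 / (4 * s) := by
      rw [hy]; field_simp; ring
    have h2 : 2 * s * α ^ 2 + -(8 * s)⁻¹ * y ^ 2 - (α * |y| - y ^ 2 / (4 * s)) =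
        (4 * s * α - |y|) ^ 2 / (8 * s) := by
      field_simp
      rw [← sq_abs y]
      ring
    have h3 : 0 ≤ (4 * s * α - |y|) ^ 2 / (8 * s) := by positivity
    linarith
  calc (1 + |x|) ^ α * Real.exp (-(x ^ 2 / (4 * s)) + v * x)
      ≤ (1 + 2 * s * |v|) ^ α * Real.exp (α * |y|) *
          Real.exp (-(x ^ 2 / (4 * s)) + v * x) := by gcongr
    _ = (1 + 2 * s * |v|) ^ α * Real.exp (α * |y| + (-(x ^ 2 / (4 * s)) + v * x)) := by
        rw [Real.exp_add (α * |y|), mul_assoc]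
    _ ≤ (1 + 2 * s * |v|) ^ α *
          Real.exp (s * v ^ 2 + (2 * s * α ^ 2 + -(8 * s)⁻¹ * y ^ 2)) := by gcongr
    _ = _ := by rw [Real.exp_add, Real.exp_add]; ring

/-- Pointwise domination of an exponential moment by a shifted Gaussian plus the weighted `p`-th
power. -/
lemma mul_exp_le_gaussian_add_weight {p s k a : ℝ} (hp : 1 ≤ p) (hs : 0 < s) (hk : 0 ≤ k)
    (ha : 0 ≤ a) (v x : ℝ) :
    a * Real.exp (v * x) ≤
      Real.exp (s * v ^ 2) * (1 + 2 * s * |v|) ^ (k / p) * (Real.exp (2 * s * (k / p) ^ 2) *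
        (Real.exp (-(8 * s)⁻¹ * (x - 2 * s * v) ^ 2) +
          a ^ p * Real.exp (p / (4 * s) * x ^ 2) / (1 + |x|) ^ k)) := by
  have hp0 : 0 < p := by linarith
  have hx : 0 < 1 + |x| := by positivity
  set h := a * Real.exp (x ^ 2 / (4 * s)) / (1 + |x|) ^ (k / p) with hh
  have hh0 : 0 ≤ h := by positivity
  have hH : a ^ p * Real.exp (p / (4 * s) * x ^ 2) / (1 + |x|) ^ k = h ^ p := by
    rw [hh, Real.div_rpow (by positivity) (by positivity), Real.mul_rpow ha (Real.exp_pos _).le,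
      ← Real.rpow_mul hx.le, div_mul_cancel₀ _ hp0.ne', ← Real.exp_mul]
    ring_nf
  have hle : h ≤ 1 + h ^ p := by
    rcases le_total h 1 with h1 | h1
    · linarith [Real.rpow_nonneg hh0 p]
    · linarith [Real.self_le_rpow_of_one_le h1 hp]
  have key := one_add_abs_rpow_mul_exp_le hs (by positivity : 0 ≤ k / p) v x
  set E := Real.exp (-(8 * s)⁻¹ * (x - 2 * s * v) ^ 2) with hE
  have hE1 : E ≤ 1 := by
    rw [hE, Real.exp_le_one_iff]
    have : 0 ≤ (8 * s)⁻¹ * (x - 2 * s * v) ^ 2 := by positivity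
    linarith
  have hE0 : 0 ≤ E := (Real.exp_pos _).le
  rw [hH]
  calc a * Real.exp (v * x)
      = h * ((1 + |x|) ^ (k / p) * Real.exp (-(x ^ 2 / (4 * s)) + v * x)) := by
        have : (1 + |x|) ^ (k / p) ≠ 0 := by positivity
        rw [hh, Real.exp_add, Real.exp_neg]
        field_simp
    _ ≤ (1 + h ^ p) * (Real.exp (s * v ^ 2) * (1 + 2 * s * |v|) ^ (k / p) *
          (Real.exp (2 * s * (k / p) ^ 2) * E)) := by gcongr
    _ = Real.exp (s * v ^ 2) * (1 + 2 * s * |v|) ^ (k / p) * (Real.exp (2 * s * (k / p) ^ 2) *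
          (E + h ^ p * E)) := by ring
    _ ≤ _ := by
        gcongr
        exact mul_le_of_le_one_right (by positivity) hE1

/-- The two-sided Laplace transform of `‖f‖` under a Gaussian-weighted `L^p` condition. -/
lemma integrable_norm_mul_exp_and_integral_le {f : ℝ → ℂ} {p s k : ℝ} (hp : 1 ≤ p) (hs : 0 < s)
    (hk : 0 ≤ k) (hmeas : AEStronglyMeasurable f volume)
    (hi : Integrable (fun x : ℝ =>
      ‖f x‖ ^ p * Real.exp (p / (4 * s) * x ^ 2) / (1 + |x|) ^ k)) :
    (∀ v : ℝ, Integrable fun x : ℝ => ‖f x‖ * Real.exp (v * x)) ∧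
      ∃ C : ℝ, 0 ≤ C ∧ ∀ v : ℝ, ∫ x : ℝ, ‖f x‖ * Real.exp (v * x) ≤
        C * (Real.exp (s * v ^ 2) * (1 + 2 * s * |v|) ^ (k / p)) := by
  have hG : Integrable fun x : ℝ => Real.exp (-(8 * s)⁻¹ * x ^ 2) :=
    integrable_exp_neg_mul_sq (by positivity)
  have hB (v : ℝ) := ((((hG.comp_sub_right (2 * s * v)).add hi).const_mul
    (Real.exp (2 * s * (k / p) ^ 2))).const_mul
      (Real.exp (s * v ^ 2) * (1 + 2 * s * |v|) ^ (k / p)))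
  have hint (v : ℝ) : Integrable fun x : ℝ => ‖f x‖ * Real.exp (v * x) := by
    refine (hB v).mono' (hmeas.norm.mul (by fun_prop)) (.of_forall fun x => ?_)
    rw [Real.norm_of_nonneg (by positivity)]
    exact mul_exp_le_gaussian_add_weight hp hs hk (norm_nonneg _) v x
  refine ⟨hint, Real.exp (2 * s * (k / p) ^ 2) * ((∫ x : ℝ, Real.exp (-(8 * s)⁻¹ * x ^ 2)) +
    ∫ x : ℝ, ‖f x‖ ^ p * Real.exp (p / (4 * s) * x ^ 2) / (1 + |x|) ^ k), ?_, fun v => ?_⟩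
  · have h1 : 0 ≤ ∫ x : ℝ, Real.exp (-(8 * s)⁻¹ * x ^ 2) :=
      integral_nonneg fun x => (Real.exp_pos _).le
    have h2 : 0 ≤ ∫ x : ℝ, ‖f x‖ ^ p * Real.exp (p / (4 * s) * x ^ 2) / (1 + |x|) ^ k :=
      integral_nonneg fun x => by positivity
    positivity
  · refine (integral_mono (hint v) (hB v) fun x =>
      mul_exp_le_gaussian_add_weight hp hs hk (norm_nonneg _) v x).trans_eq ?_
    simp only [Pi.add_apply]
    rw [integral_const_mul, integral_const_mul, integral_add (hG.comp_sub_right _) hi,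
      integral_sub_right_eq_self (fun x : ℝ => Real.exp (-(8 * s)⁻¹ * x ^ 2))]
    ring

/-- The Fourier–Laplace transform of a function with all exponential moments is entire. -/
lemma differentiable_integral_mul_cexp {f : ℝ → ℂ} (hmeas : AEStronglyMeasurable f volume)
    (hint : ∀ v : ℝ, Integrable fun x : ℝ => ‖f x‖ * Real.exp (v * x)) :
    Differentiable ℂ fun z : ℂ => ∫ x : ℝ, f x * Complex.exp (-Complex.I * z * x) := by
  intro z₀
  have hnorm (z : ℂ) (x : ℝ) : ‖Complex.exp (-Complex.I * z * x)‖ = Real.exp (z.im * x) := by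
    rw [Complex.norm_exp]; simp
  set a := ‖z₀‖ + 2 with ha
  refine (hasDerivAt_integral_of_dominated_loc_of_deriv_le
    (F' := fun z x => f x * (Complex.exp (-Complex.I * z * x) * (-Complex.I * x)))
    (bound := fun x => ‖f x‖ * Real.exp (a * x) + ‖f x‖ * Real.exp (-a * x))
    (Metric.ball_mem_nhds z₀ one_pos) (.of_forall fun z => hmeas.mul (by fun_prop))
    ?_ (hmeas.mul (by fun_prop)) (.of_forall fun x z hz => ?_) ((hint a).add (hint (-a)))
    (.of_forall fun x z hz => ?_)).2.differentiableAt
  · refine (hint z₀.im).mono' (hmeas.mul (by fun_prop)) (.of_forall fun x => ?_)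
    rw [Pi.mul_apply, norm_mul, hnorm]
  · have hz' : |z.im| ≤ ‖z₀‖ + 1 := by
      have h1 := Complex.abs_im_le_norm z
      have h2 : ‖z‖ ≤ ‖z - z₀‖ + ‖z₀‖ := by simpa using norm_add_le (z - z₀) z₀
      rw [mem_ball_iff_norm] at hz
      linarith
    have h3 : Real.exp (z.im * x) * |x| ≤ Real.exp (a * |x|) := by
      have h5 : z.im * x ≤ (‖z₀‖ + 1) * |x| :=
        (le_abs_self _).trans (by rw [abs_mul]; gcongr)
      have h6 : |x| ≤ Real.exp |x| := by linarith [Real.add_one_le_exp |x|]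
      calc Real.exp (z.im * x) * |x| ≤ Real.exp ((‖z₀‖ + 1) * |x|) * Real.exp |x| :=
            mul_le_mul (Real.exp_le_exp.2 h5) h6 (abs_nonneg x) (Real.exp_pos _).le
        _ = _ := by rw [← Real.exp_add]; congr 1; rw [ha]; ring
    have h4 : Real.exp (a * |x|) ≤ Real.exp (a * x) + Real.exp (-a * x) := by
      rcases abs_cases x with ⟨h, _⟩ | ⟨h, _⟩ <;> rw [h]
      · linarith [Real.exp_pos (-a * x)]
      · rw [mul_neg, ← neg_mul]; linarith [Real.exp_pos (a * x)]
    rw [norm_mul, norm_mul, hnorm, ← mul_add]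
    simp only [norm_mul, norm_neg, Complex.norm_I, one_mul, Complex.norm_real, Real.norm_eq_abs]
    gcongr
    exact h3.trans h4
  · have h : HasDerivAt (fun z : ℂ => -Complex.I * z * x) (-Complex.I * x) z := by
      simpa using ((hasDerivAt_id z).const_mul (-Complex.I)).mul_const (x : ℂ)
    exact h.cexp.const_mul (f x)

/-- A Phragmén–Lindelöf principle of critical order in the first quadrant. -/
lemma norm_le_of_quadrant_of_norm_le_exp_re_sq {K : ℂ → ℂ} {B s : ℝ}
    (hK : ∀ z : ℂ, 0 ≤ z.re → DifferentiableAt ℂ K z) (hs : 0 ≤ s)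
    (hbd : ∀ z : ℂ, 0 ≤ z.re → 0 ≤ z.im → ‖K z‖ ≤ B * Real.exp (s * z.re ^ 2))
    (hreal : ∀ u : ℝ, 0 ≤ u → ‖K u‖ ≤ B) {z : ℂ} (hre : 0 ≤ z.re) (him : 0 ≤ z.im) :
    ‖K z‖ ≤ B := by
  have hB : 0 ≤ B := (norm_nonneg _).trans (hreal 0 le_rfl)
  rcases hre.eq_or_lt with h0 | hre
  · simpa [← h0] using hbd z h0.le him
  have hz0 : z ≠ 0 := by rintro rfl; simp at hre
  have hnorm (c : ℝ) (z : ℂ) : ‖K z * Complex.exp (c * Complex.I * z ^ 2)‖ =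
      ‖K z‖ * Real.exp (-(2 * c * z.re * z.im)) := by
    rw [norm_mul, Complex.norm_exp]
    congr 2
    simp [sq]
    ring
  have key (c : ℝ) (hc : 0 < c) : ‖K z‖ * Real.exp (-(2 * c * z.re * z.im)) ≤ B := by
    obtain ⟨θ, hθ0, hθ2, hzθ, hθ⟩ : ∃ θ : ℝ, 0 < θ ∧ θ < π / 2 ∧ z.arg ≤ θ ∧
        s * Real.cos θ ≤ 2 * c * Real.sin θ := by
      have harg : z.arg < π / 2 := Complex.arg_lt_pi_div_two_iff.2 (.inl hre)
      have h1 : ∀ᶠ θ in nhds (π / 2), s * Real.cos θ < 2 * c * Real.sin θ :=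
        ContinuousAt.eventually_lt (by fun_prop) (by fun_prop) (by simpa using hc)
      have h2 := (h1.filter_mono nhdsWithin_le_nhds).and
        (Ioo_mem_nhdsLT (max_lt harg Real.pi_div_two_pos))
      obtain ⟨θ, h3, h4, h5⟩ := h2.exists
      exact ⟨θ, (le_max_right _ _).trans_lt h4, h5, ((le_max_left _ _).trans_lt h4).le, h3.le⟩
    have hquad {w : ℂ} (h1 : 0 ≤ w.im) (h2 : w.im ≤ θ) :
        0 ≤ (Complex.exp w).re ∧ 0 ≤ (Complex.exp w).im := by
      rw [Complex.exp_re, Complex.exp_im]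
      have := Real.cos_nonneg_of_mem_Icc (x := w.im) ⟨by linarith, by linarith⟩
      have := Real.sin_nonneg_of_nonneg_of_le_pi h1 (by linarith)
      constructor <;> positivity
    have hPL := PhragmenLindelof.horizontal_strip (a := 0) (b := θ) (C := B) (z := Complex.log z)
      (f := fun w => K (Complex.exp w) * Complex.exp (c * Complex.I * Complex.exp w ^ 2))
      ?_ ?_ ?_ ?_ (by rw [Complex.log_im]; exact Complex.arg_nonneg_iff.2 him)
      (by rwa [Complex.log_im])
    · simpa only [Complex.exp_log hz0, hnorm] using hPL
    · refine DifferentiableOn.diffContOnCl fun w hw => ?_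
      have hcl : w.im ∈ Set.Icc 0 θ := by
        have : w ∈ Complex.im ⁻¹' Set.Icc 0 θ :=
          closure_minimal (Set.preimage_mono Set.Ioo_subset_Icc_self)
            (isClosed_Icc.preimage Complex.continuous_im) hw
        exact this
      have h := (hK _ (hquad hcl.1 hcl.2).1).comp w Complex.differentiable_exp.differentiableAt
      exact (DifferentiableAt.mul h (by fun_prop)).differentiableWithinAt
    · refine ⟨2, ?_, s, ?_⟩
      · rw [sub_zero, lt_div_iff₀ hθ0]; linarith
      refine Asymptotics.IsBigO.of_bound B ?_
      refine Filter.eventually_inf_principal.2 (.of_forall fun w hw => ?_)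
      obtain ⟨h1, h2⟩ := hquad hw.1.le hw.2.le
      rw [hnorm, Real.norm_of_nonneg (Real.exp_pos _).le]
      calc ‖K (Complex.exp w)‖ * Real.exp (-(2 * c * (Complex.exp w).re * (Complex.exp w).im))
          ≤ B * Real.exp (s * (Complex.exp w).re ^ 2) * 1 := by
            gcongr
            · exact hbd _ h1 h2
            · rw [Real.exp_le_one_iff]
              have : 0 ≤ 2 * c * (Complex.exp w).re * (Complex.exp w).im := by positivity
              linarith
        _ ≤ B * Real.exp (s * Real.exp (2 * |w.re|)) := by
            rw [mul_one]
            gcongr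
            calc (Complex.exp w).re ^ 2 ≤ ‖Complex.exp w‖ ^ 2 := by
                  gcongr; exact Complex.re_le_norm _
              _ = Real.exp (2 * w.re) := by
                  rw [Complex.norm_exp, ← Real.exp_nat_mul]; norm_num
              _ ≤ _ := by gcongr; exact le_abs_self _
    · intro w hw
      have hexp : Complex.exp w = (Real.exp w.re : ℝ) := by
        apply Complex.ext
        · simp [Complex.exp_re, hw]
        · simp [Complex.exp_im, hw]
      rw [hnorm, hexp]
      simpa using hreal _ (Real.exp_pos w.re).le
    · intro w hw
      obtain ⟨h1, h2⟩ := hquad (w := w) (by rw [hw]; exact hθ0.le) hw.le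
      rw [hnorm]
      calc _ ≤ B * Real.exp (s * (Complex.exp w).re ^ 2) *
            Real.exp (-(2 * c * (Complex.exp w).re * (Complex.exp w).im)) := by
            gcongr; exact hbd _ h1 h2
        _ = B * Real.exp (s * (Complex.exp w).re ^ 2 +
            -(2 * c * (Complex.exp w).re * (Complex.exp w).im)) := by
            rw [Real.exp_add, mul_assoc]
        _ ≤ B * 1 := by
            gcongr
            rw [Real.exp_le_one_iff, Complex.exp_re, Complex.exp_im, hw]
            have hcos : 0 ≤ Real.cos θ := Real.cos_nonneg_of_mem_Icc ⟨by linarith, by linarith⟩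
            have : 0 ≤ Real.exp w.re ^ 2 * Real.cos θ *
                (2 * c * Real.sin θ - s * Real.cos θ) :=
              mul_nonneg (by positivity) (by linarith)
            linarith
        _ = B := mul_one B
  have hlim : Filter.Tendsto (fun c : ℝ => ‖K z‖ * Real.exp (-(2 * c * z.re * z.im)))
      (nhdsWithin 0 (Set.Ioi 0)) (nhds ‖K z‖) := by
    have : Continuous fun c : ℝ => ‖K z‖ * Real.exp (-(2 * c * z.re * z.im)) := by fun_prop
    simpa using (this.tendsto 0).mono_left nhdsWithin_le_nhds
  exact le_of_tendsto hlim (eventually_nhdsWithin_of_forall key)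

/-- In a closed quadrant, an entire function that is `O((1 + |z|) ^ N * exp (s (re z)²))` and of
polynomial growth on the real half-line is of polynomial growth. -/
lemma norm_le_one_add_norm_pow_of_quadrant {G : ℂ → ℂ} {A s : ℝ} {N : ℕ}
    (hG : Differentiable ℂ G) (hs : 0 ≤ s)
    (hbd : ∀ z : ℂ, ‖G z‖ ≤ A * (1 + ‖z‖) ^ N * Real.exp (s * z.re ^ 2))
    (hreal : ∀ u : ℝ, ‖G u‖ ≤ A * (1 + |u|) ^ N) {z : ℂ} (hre : 0 ≤ z.re) (him : 0 ≤ z.im) :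
    ‖G z‖ ≤ A * 2 ^ N * (1 + ‖z‖) ^ N := by
  have hA : 0 ≤ A := by simpa using (norm_nonneg _).trans (hreal 0)
  have hlow {z : ℂ} (hz : 0 ≤ z.re) : 1 ≤ ‖z + 1‖ ∧ 1 + ‖z‖ ≤ 2 * ‖z + 1‖ := by
    have h1 : 1 ≤ ‖z + 1‖ := by
      have := Complex.re_le_norm (z + 1)
      simp at this
      linarith
    have h2 : ‖z‖ ≤ ‖z + 1‖ := by
      rw [← sq_le_sq₀ (norm_nonneg _) (norm_nonneg _), Complex.sq_norm, Complex.sq_norm,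
        Complex.normSq_apply, Complex.normSq_apply]
      simp
      nlinarith
    exact ⟨h1, by linarith⟩
  have hdiv {z : ℂ} (hz : 0 ≤ z.re) {M : ℝ} (hM : 0 ≤ M) (h : ‖G z‖ ≤ A * (1 + ‖z‖) ^ N * M) :
      ‖G z / (z + 1) ^ N‖ ≤ A * 2 ^ N * M := by
    obtain ⟨h1, h2⟩ := hlow hz
    rw [norm_div, norm_pow, div_le_iff₀ (by positivity)]
    calc ‖G z‖ ≤ A * (1 + ‖z‖) ^ N * M := h
      _ ≤ A * (2 * ‖z + 1‖) ^ N * M := by gcongr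
      _ = _ := by rw [mul_pow]; ring
  have hne {z : ℂ} (hz : 0 ≤ z.re) : (z + 1) ^ N ≠ 0 := by
    refine pow_ne_zero _ (norm_pos_iff.1 ?_)
    linarith [(hlow hz).1]
  have key : ‖G z / (z + 1) ^ N‖ ≤ A * 2 ^ N := by
    refine norm_le_of_quadrant_of_norm_le_exp_re_sq (K := fun z => G z / (z + 1) ^ N)
      (fun w hw => (hG w).div (by fun_prop) (hne hw)) hs
      (fun w hw _ => hdiv hw (Real.exp_pos _).le (hbd w)) (fun u hu => ?_) hre him
    simpa using hdiv (z := (u : ℂ)) (by simpa) zero_le_one (by simpa using hreal u)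
  rw [norm_div, div_le_iff₀ (norm_pos_iff.2 (hne hre)), norm_pow] at key
  refine key.trans ?_
  gcongr
  simpa [add_comm] using norm_add_le z 1

/-- Polynomial growth on the whole plane, obtained from the four quadrants by symmetry. -/
lemma norm_le_one_add_norm_pow {G : ℂ → ℂ} {A s : ℝ} {N : ℕ}
    (hG : Differentiable ℂ G) (hs : 0 ≤ s)
    (hbd : ∀ z : ℂ, ‖G z‖ ≤ A * (1 + ‖z‖) ^ N * Real.exp (s * z.re ^ 2))
    (hreal : ∀ u : ℝ, ‖G u‖ ≤ A * (1 + |u|) ^ N) (z : ℂ) :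
    ‖G z‖ ≤ A * 2 ^ N * (1 + ‖z‖) ^ N := by
  wlog hre : 0 ≤ z.re generalizing G z
  · simpa using this (G := fun z => G (-z)) (hG.comp differentiable_neg)
      (fun w => by simpa using hbd (-w)) (fun u => by simpa using hreal (-u)) (-z)
      (by simpa using (not_le.1 hre).le)
  rcases le_total 0 z.im with him | him
  · exact norm_le_one_add_norm_pow_of_quadrant hG hs hbd hreal hre him
  · have := norm_le_one_add_norm_pow_of_quadrant (G := fun z => star (G (star z))) (A := A)
      (s := s) (N := N) (z := star z)
      (fun w => by simpa [Function.comp_def] using (hG (star w)).star_star) hs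
      (fun w => by simpa using hbd (star w)) (fun u => by simpa using hreal u)
      (by simpa using hre) (by simpa using him)
    simpa using this

/-- An entire function of polynomial growth is a polynomial. -/
lemma exists_polynomial_of_norm_le {G : ℂ → ℂ} {A : ℝ} {N : ℕ} (hG : Differentiable ℂ G)
    (hbd : ∀ z : ℂ, ‖G z‖ ≤ A * (1 + ‖z‖) ^ N) : ∃ P : Polynomial ℂ, ∀ z, G z = P.eval z := by
  have hA : 0 ≤ A := by simpa using (norm_nonneg _).trans (hbd 0)
  have hzero (n : ℕ) (hn : N < n) : iteratedDeriv n G 0 = 0 := by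
    have hle (R : ℝ) (hR : 1 ≤ R) :
        ‖iteratedDeriv n G 0‖ ≤ n.factorial * (A * 2 ^ N) * R⁻¹ := by
      have hR0 : 0 < R := by linarith
      refine (Complex.norm_iteratedDeriv_le_of_forall_mem_sphere_norm_le (C := A * (2 * R) ^ N) n
        hR0 hG.diffContOnCl fun z hz => (hbd z).trans ?_).trans ?_
      · rw [mem_sphere_zero_iff_norm] at hz
        rw [hz]
        gcongr
        linarith
      · rw [div_le_iff₀ (by positivity), mul_pow]
        calc n.factorial * (A * (2 ^ N * R ^ N))
            = n.factorial * (A * 2 ^ N) * R⁻¹ * R ^ (N + 1) := by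
              rw [pow_succ]; field_simp
          _ ≤ _ := by gcongr; exact hn
    have hlim : Filter.Tendsto (fun R : ℝ => n.factorial * (A * 2 ^ N) * R⁻¹) Filter.atTop
        (nhds 0) := by
      simpa using tendsto_inv_atTop_zero.const_mul (n.factorial * (A * 2 ^ N))
    exact norm_le_zero_iff.1 (ge_of_tendsto hlim (Filter.eventually_ge_atTop 1 |>.mono hle))
  refine ⟨∑ n ∈ Finset.range (N + 1),
    Polynomial.C ((n.factorial : ℂ)⁻¹ * iteratedDeriv n G 0) * Polynomial.X ^ n, fun z => ?_⟩
  rw [← Complex.taylorSeries_eq_of_entire' 0 z hG, tsum_eq_sum (s := Finset.range (N + 1))]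
  · simp [Polynomial.eval_finsetSum]
  · intro n hn
    rw [hzero n (by simpa using hn)]
    simp

/-- An entire function that is `O((1 + |z|) ^ N * exp (s (re z)²))` and lies in a polynomially
weighted `L^q` space on the real line is a polynomial. -/
lemma exists_polynomial_of_integrable_rpow {g : ℂ → ℂ} {A s q l : ℝ} {N : ℕ}
    (hg : Differentiable ℂ g) (hs : 0 ≤ s) (hq : 1 ≤ q) (hl : 0 ≤ l)
    (hbd : ∀ z : ℂ, ‖g z‖ ≤ A * (1 + ‖z‖) ^ N * Real.exp (s * z.re ^ 2))
    (hint : Integrable fun u : ℝ => ‖g u‖ ^ q / (1 + |u|) ^ l) :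
    ∃ P : Polynomial ℂ, ∀ z, g z = P.eval z := by
  obtain ⟨G, hG0, hG⟩ := hg.isExactOn_univ.with_val_at 0 0
  replace hG : ∀ z, HasDerivAt G (g z) z := fun z => hG z trivial
  have hA : 0 ≤ A := by
    simpa using (norm_nonneg _).trans (hbd 0)
  set J := ∫ u : ℝ, ‖g u‖ ^ q / (1 + |u|) ^ l
  have hJ0 : 0 ≤ J := integral_nonneg fun u => by positivity
  have hGbd (z : ℂ) : ‖G z‖ ≤ A * (1 + ‖z‖) ^ (N + 1) * Real.exp (s * z.re ^ 2) := by
    have h := Convex.norm_image_sub_le_of_norm_hasDerivWithin_le (f := G) (f' := g)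
      (C := A * (1 + ‖z‖) ^ N * Real.exp (s * z.re ^ 2)) (s := segment ℝ 0 z) (x := 0) (y := z)
      (fun w _ => (hG w).hasDerivWithinAt) (fun w hw => ?_) (convex_segment _ _)
      (left_mem_segment _ _ _) (right_mem_segment _ _ _)
    · rw [hG0, sub_zero, sub_zero] at h
      refine h.trans ?_
      calc A * (1 + ‖z‖) ^ N * Real.exp (s * z.re ^ 2) * ‖z‖
          ≤ A * (1 + ‖z‖) ^ N * Real.exp (s * z.re ^ 2) * (1 + ‖z‖) := by gcongr; linarith
        _ = _ := by ring
    · rw [segment_eq_image] at hw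
      obtain ⟨t, ⟨ht0, ht1⟩, rfl⟩ := hw
      have h1 : ‖(1 - t) • (0 : ℂ) + t • z‖ ≤ ‖z‖ := by
        rw [smul_zero, zero_add, norm_smul, Real.norm_of_nonneg ht0]
        exact mul_le_of_le_one_left (norm_nonneg _) ht1
      have h2 : ((1 - t) • (0 : ℂ) + t • z).re ^ 2 ≤ z.re ^ 2 := by
        rw [smul_zero, zero_add, Complex.smul_re, smul_eq_mul, mul_pow]
        exact mul_le_of_le_one_left (sq_nonneg _) (pow_le_one₀ ht0 ht1)
      refine (hbd _).trans ?_
      gcongr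
  have hGreal (u : ℝ) : ‖G u‖ ≤ |u| + (1 + |u|) ^ l * J := by
    have hcont : Continuous fun t : ℝ => g t := hg.continuous.comp Complex.continuous_ofReal
    have hftc : ∫ t in (0 : ℝ)..u, g t = G u := by
      rw [intervalIntegral.integral_eq_sub_of_hasDerivAt (f := fun t : ℝ => G t)
        (fun t _ => (hG t).comp_ofReal) (hcont.intervalIntegrable _ _)]
      simp [hG0]
    have hle (t : ℝ) (ht : t ∈ Set.uIoc 0 u) :
        ‖g t‖ ≤ 1 + (1 + |u|) ^ l * (‖g t‖ ^ q / (1 + |t|) ^ l) := by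
      have htu : |t| ≤ |u| := by
        rcases Set.mem_uIoc.1 ht with ⟨h1, h2⟩ | ⟨h1, h2⟩
        · rwa [abs_of_pos h1, abs_of_pos (h1.trans_le h2)]
        · rw [abs_of_nonpos h2, abs_of_nonpos (h1.le.trans h2)]; linarith
      have h1 : ‖g t‖ ≤ 1 + ‖g t‖ ^ q := by
        rcases le_total ‖g t‖ 1 with h | h
        · linarith [Real.rpow_nonneg (norm_nonneg (g t)) q]
        · linarith [Real.self_le_rpow_of_one_le h hq]
      have h2 : ‖g t‖ ^ q ≤ (1 + |u|) ^ l * (‖g t‖ ^ q / (1 + |t|) ^ l) := by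
        rw [mul_div_assoc', le_div_iff₀ (by positivity), mul_comm]
        gcongr
      linarith
    rw [← hftc]
    refine intervalIntegral.norm_integral_le_integral_norm_uIoc.trans ?_
    have hone : IntegrableOn (fun _ : ℝ => (1 : ℝ)) (Set.uIoc 0 u) := by
      rw [integrableOn_const_iff]; simp [Set.uIoc]
    have hmul := (hint.const_mul ((1 + |u|) ^ l)).integrableOn (s := Set.uIoc 0 u)
    refine (setIntegral_mono_on (hcont.norm.integrableOn_uIoc) (hone.add hmul)
      measurableSet_uIoc hle).trans ?_
    simp only [Pi.add_apply]
    rw [integral_add hone hmul]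
    refine add_le_add ?_ ?_
    · simp [Set.uIoc, max_sub_min_eq_abs, Measure.real]
    · rw [integral_const_mul]
      gcongr
      exact setIntegral_le_integral hint (.of_forall fun t => by positivity)
  set M := N + 1 + ⌈l⌉₊ with hM
  have hlM : l ≤ M := (Nat.le_ceil l).trans (by rw [hM]; push_cast; linarith)
  have hpow {x : ℝ} (hx : 0 ≤ x) : A * (1 + x) ^ (N + 1) ≤ (A + 1 + J) * (1 + x) ^ M := by
    gcongr <;> linarith
  have hGreal' (u : ℝ) : ‖G u‖ ≤ (A + 1 + J) * (1 + |u|) ^ M := by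
    refine (hGreal u).trans ?_
    have h1 : 1 ≤ 1 + |u| := by linarith [abs_nonneg u]
    have h2 : (1 + |u|) ^ l ≤ (1 + |u|) ^ M := by
      rw [← Real.rpow_natCast]
      exact Real.rpow_le_rpow_of_exponent_le h1 hlM
    have h3 : |u| ≤ (1 + |u|) ^ M :=
      (le_add_of_nonneg_left zero_le_one).trans (le_self_pow₀ h1 (by omega))
    have h4 : 0 ≤ A * (1 + |u|) ^ M := by positivity
    nlinarith [mul_le_mul_of_nonneg_right h2 hJ0]
  have hGbd' (z : ℂ) : ‖G z‖ ≤ (A + 1 + J) * (1 + ‖z‖) ^ M * Real.exp (s * z.re ^ 2) :=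
    (hGbd z).trans (mul_le_mul_of_nonneg_right (hpow (norm_nonneg z)) (Real.exp_pos _).le)
  have hGdiff : Differentiable ℂ G := fun z => (hG z).differentiableAt
  obtain ⟨Q, hQ⟩ := exists_polynomial_of_norm_le hGdiff
    (norm_le_one_add_norm_pow hGdiff hs hGbd' hGreal')
  refine ⟨Q.derivative, fun z => (hG z).unique ?_⟩
  rw [funext hQ]
  exact Q.hasDerivAt z

/-- Away from a disc, a nonzero polynomial is bounded below by a multiple of its leading power. -/
lemma Polynomial.exists_mul_norm_pow_natDegree_le {P : Polynomial ℂ} (hP : P ≠ 0) :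
    ∃ c > 0, ∃ R ≥ 1, ∀ z : ℂ, R ≤ ‖z‖ → c * ‖z‖ ^ P.natDegree ≤ ‖P.eval z‖ := by
  have hlead : 0 < ‖P.leadingCoeff‖ := norm_pos_iff.2 (Polynomial.leadingCoeff_ne_zero.2 hP)
  have h0 : P.reverse.eval 0 = P.leadingCoeff := by
    rw [← Polynomial.coeff_zero_eq_eval_zero, Polynomial.coeff_zero_reverse]
  have hev : ∀ᶠ w in nhds (0 : ℂ), ‖P.leadingCoeff‖ / 2 < ‖P.reverse.eval w‖ := by
    have hc : Continuous fun w : ℂ => ‖P.reverse.eval w‖ := P.reverse.continuous.norm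
    refine hc.continuousAt.eventually_const_lt ?_
    simp only [h0]
    linarith
  obtain ⟨ε, hε, hball⟩ := Metric.eventually_nhds_iff_ball.1 hev
  refine ⟨‖P.leadingCoeff‖ / 2, by positivity, max 1 (2 / ε), le_max_left _ _, fun z hz => ?_⟩
  have hz0 : 0 < ‖z‖ := zero_lt_one.trans_le ((le_max_left _ _).trans hz)
  let := invertibleOfNonzero (norm_pos_iff.1 hz0)
  have heq := Polynomial.eval₂_reverse_mul_pow (RingHom.id ℂ) z P
  rw [Polynomial.eval₂_id, Polynomial.eval₂_id, invOf_eq_inv] at heq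
  rw [← heq, norm_mul, norm_pow]
  gcongr
  refine (hball _ ?_).le
  rw [mem_ball_zero_iff, norm_inv, inv_lt_comm₀ hz0 hε]
  calc ε⁻¹ < 2 / ε := by rw [inv_eq_one_div]; gcongr; norm_num
    _ ≤ ‖z‖ := (le_max_right _ _).trans hz

lemma Polynomial.natDegree_le_of_norm_eval_mul_I_le {P : Polynomial ℂ} {C a α : ℝ} (ha : 0 ≤ a)
    (hα : 0 ≤ α) (h : ∀ v : ℝ, ‖P.eval (v * Complex.I)‖ ≤ C * (1 + a * |v|) ^ α) :
    (P.natDegree : ℝ) ≤ α := by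
  rcases eq_or_ne P 0 with rfl | hP
  · simpa
  have hC : 0 ≤ C := by simpa using (norm_nonneg _).trans (h 0)
  obtain ⟨c, hc, R, hR, hlow⟩ := Polynomial.exists_mul_norm_pow_natDegree_le hP
  by_contra! hd
  have hbd (v : ℝ) (hv : R ≤ v) : v ^ (P.natDegree - α) ≤ C * (1 + a) ^ α / c := by
    have hv0 : 0 < v := by linarith
    have h1 := hlow (v * Complex.I) (by simpa [abs_of_pos hv0] using hv)
    have h2 : c * v ^ P.natDegree ≤ C * (1 + a * |v|) ^ α :=
      (by simpa [abs_of_pos hv0] using h1 : c * v ^ P.natDegree ≤ _).trans (h v)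
    have h3 : (1 + a * |v|) ^ α ≤ (1 + a) ^ α * v ^ α := by
      rw [← Real.mul_rpow (by positivity) hv0.le, abs_of_pos hv0]
      gcongr
      linarith
    rw [Real.rpow_sub hv0, Real.rpow_natCast, div_le_div_iff₀ (by positivity) hc]
    calc v ^ P.natDegree * c ≤ C * (1 + a * |v|) ^ α := by linarith
      _ ≤ C * ((1 + a) ^ α * v ^ α) := by gcongr
      _ = _ := by ring
  obtain ⟨v, hv1, hv2⟩ := ((tendsto_rpow_atTop (sub_pos.2 hd)).eventually_gt_atTop
    (C * (1 + a) ^ α / c)).and (Filter.eventually_ge_atTop R) |>.exists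
  exact absurd (hbd v hv2) (not_le.2 hv1)

lemma Polynomial.natDegree_lt_of_integrable_rpow {P : Polynomial ℂ} {q l : ℝ} (hq : 0 < q)
    (hl : 1 < l) (h : Integrable fun u : ℝ => ‖P.eval (u : ℂ)‖ ^ q / (1 + |u|) ^ l) :
    (P.natDegree : ℝ) < (l - 1) / q := by
  rcases eq_or_ne P 0 with rfl | hP
  · simpa using div_pos (sub_pos.2 hl) hq
  obtain ⟨c, hc, R, hR, hlow⟩ := Polynomial.exists_mul_norm_pow_natDegree_le hP
  have hint : IntegrableOn (fun u : ℝ => u ^ (P.natDegree * q - l)) (Set.Ioi R) := by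
    refine Integrable.mono' (h.const_mul (2 ^ l / c ^ q)).integrableOn
      (by fun_prop) ?_
    refine (ae_restrict_iff' measurableSet_Ioi).2 (.of_forall fun u hu => ?_)
    have huR : R < u := hu
    have hu0 : 0 < u := by linarith
    have h1 : c * u ^ P.natDegree ≤ ‖P.eval (u : ℂ)‖ := by
      simpa [abs_of_pos hu0] using hlow u (by simpa [abs_of_pos hu0] using huR.le)
    rw [Real.norm_of_nonneg (by positivity), abs_of_pos hu0]
    calc u ^ (P.natDegree * q - l) = 2 ^ l / c ^ q * ((c * u ^ P.natDegree) ^ q / (2 * u) ^ l) := by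
          rw [Real.mul_rpow hc.le (by positivity), Real.mul_rpow two_pos.le hu0.le,
            Real.rpow_sub hu0, Real.rpow_mul hu0.le, Real.rpow_natCast]
          have : c ^ q ≠ 0 := by positivity
          field_simp
      _ ≤ _ := by
          gcongr
          linarith
  have := (integrableOn_Ioi_rpow_iff (by linarith)).1 hint
  rw [lt_div_iff₀ hq]
  linarith

open FourierTransform in
/-- Injectivity of the Fourier transform on integrable functions. -/
lemma ae_eq_zero_of_integral_mul_cexp_eq_zero {f : ℝ → ℂ} (hf : Integrable f)
    (h : ∀ t : ℝ, ∫ x : ℝ, f x * Complex.exp (-Complex.I * t * x) = 0) : f =ᵐ[volume] 0 := by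
  have hF : 𝓕 f = 0 := by
    ext w
    rw [Real.fourier_real_eq_integral_exp_smul, Pi.zero_apply, ← h (2 * π * w)]
    congr 1 with x
    rw [smul_eq_mul, mul_comm]
    congr 2
    push_cast
    ring
  refine ae_eq_zero_of_integral_contDiff_smul_eq_zero hf.locallyIntegrable
    fun φ hφ hφc => ?_
  have hφc' : HasCompactSupport (Complex.ofRealCLM ∘ φ) := hφc.comp_left rfl
  set ψ : SchwartzMap ℝ ℂ := hφc'.toSchwartzMap (by fun_prop)
  have hψ : 𝓕 ((𝓕⁻ ψ : SchwartzMap ℝ ℂ) : ℝ → ℂ) = ψ := by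
    rw [← SchwartzMap.fourier_coe, FourierTransform.fourier_fourierInv_eq]
  have hflip : ∫ x, 𝓕 ((𝓕⁻ ψ : SchwartzMap ℝ ℂ) : ℝ → ℂ) x • f x =
      ∫ x, (𝓕⁻ ψ : SchwartzMap ℝ ℂ) x • 𝓕 f x := by
    simpa using! VectorFourier.integral_fourierIntegral_smul_eq_flip (L := innerₗ ℝ)
      Real.continuous_fourierChar continuous_inner (𝓕⁻ ψ : SchwartzMap ℝ ℂ).integrable hf
  rw [hψ, hF] at hflip
  simpa [ψ] using hflip

/-- The Fourier transform of the Gaussian `exp (-x² / 4s)`. -/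
lemma integral_gaussian_mul_cexp {s : ℝ} (hs : 0 < s) (t : ℝ) :
    ∫ x : ℝ, (Real.exp (-x ^ 2 / (4 * s)) : ℂ) * Complex.exp (-Complex.I * t * x) =
      (π * (4 * s) : ℂ) ^ (1 / 2 : ℂ) * Real.exp (-s * t ^ 2) := by
  have hs' : (s : ℂ) ≠ 0 := by exact_mod_cast hs.ne'
  have hb : 0 < (((4 * s)⁻¹ : ℝ) : ℂ).re := by
    rw [Complex.ofReal_re]; positivity
  convert! fourierIntegral_gaussian hb (-t : ℂ) using 1
  · congr 1 with x
    rw [mul_comm]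
    push_cast
    congr 2 <;> ring
  · push_cast
    congr 2
    · field_simp
    · field_simp

/-- **One-dimensional equal-parameter Cowling–Price theorem with polynomial
weights.** If `∫ |f(x)|^p e^{(p/4s)x²}(1+|x|)^{-k} dx < ∞` and
`∫ |f̂(λ)|^q e^{qsλ²}(1+|λ|)^{-l} dλ < ∞`, then `f̂(λ) = P(λ)e^{-sλ²}` for a
polynomial `P` with `deg P ≤ min{k/p + 1, (l-1)/q}`; if moreover `l ≤ q + 1` then
`f̂(λ) = c e^{-sλ²}` and `f` is a constant multiple of `e^{-x²/4s}`. -/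
theorem stmt_19 (f : ℝ → ℂ) (p q s k l : ℝ)
    (hp : 1 ≤ p) (hq : 1 ≤ q) (hs : 0 < s) (hk : 1 < k) (hl : 1 < l)
    (hmeas : AEStronglyMeasurable f volume)
    (fhat : ℝ → ℂ)
    (hfhat : ∀ lam : ℝ, fhat lam = (((2 * π) ^ (-(1 : ℝ) / 2) : ℝ) : ℂ) *
      ∫ x : ℝ, f x * Complex.exp (-Complex.I * lam * x))
    (hi : Integrable (fun x : ℝ =>
      ‖f x‖ ^ p * Real.exp (p / (4 * s) * x ^ 2) / (1 + |x|) ^ k))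
    (hii : Integrable (fun lam : ℝ =>
      ‖fhat lam‖ ^ q * Real.exp (q * s * lam ^ 2) / (1 + |lam|) ^ l)) :
    ∃ P : Polynomial ℂ,
      (∀ lam : ℝ, fhat lam = P.eval (lam : ℂ) * Real.exp (-s * lam ^ 2)) ∧
      (P.natDegree : ℝ) ≤ min (k / p + 1) ((l - 1) / q) ∧
      (l ≤ q + 1 →
        (∃ c : ℂ, ∀ lam : ℝ, fhat lam = c * Real.exp (-s * lam ^ 2)) ∧
        (∃ c' : ℂ, f =ᵐ[volume] fun x => c' * Real.exp (-x ^ 2 / (4 * s)))) := by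
  obtain ⟨hint, C, hC, hbound⟩ :=
    integrable_norm_mul_exp_and_integral_le hp hs (zero_le_one.trans hk.le) hmeas hi
  have hα : 0 ≤ k / p := by positivity
  set κ : ℝ := (2 * π) ^ (-(1 : ℝ) / 2)
  have hκ : 0 < κ := by positivity
  set F : ℂ → ℂ := fun z => ∫ x : ℝ, f x * Complex.exp (-Complex.I * z * x)
  set g : ℂ → ℂ := fun z => κ * F z * Complex.exp (s * z ^ 2) with hg_def
  have hF (z : ℂ) : ‖F z‖ ≤ C * (Real.exp (s * z.im ^ 2) * (1 + 2 * s * |z.im|) ^ (k / p)) := by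
    refine (norm_integral_le_integral_norm _).trans (le_of_eq_of_le ?_ (hbound z.im))
    congr 1 with x
    rw [norm_mul, Complex.norm_exp]
    simp
  have hg (z : ℂ) : ‖g z‖ ≤ κ * C * (1 + 2 * s * |z.im|) ^ (k / p) * Real.exp (s * z.re ^ 2) := by
    have hexp : ‖Complex.exp (s * z ^ 2)‖ = Real.exp (s * z.re ^ 2 + -(s * z.im ^ 2)) := by
      rw [Complex.norm_exp]
      congr 1
      simp [sq]
      ring
    rw [hg_def, norm_mul, norm_mul, Complex.norm_real, Real.norm_of_nonneg hκ.le, hexp,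
      Real.exp_add, Real.exp_neg]
    calc _ ≤ κ * (C * (Real.exp (s * z.im ^ 2) * (1 + 2 * s * |z.im|) ^ (k / p))) *
          (Real.exp (s * z.re ^ 2) * (Real.exp (s * z.im ^ 2))⁻¹) := by
          gcongr; exact hF z
      _ = _ := by field_simp
  have hgdiff : Differentiable ℂ g :=
    ((differentiable_integral_mul_cexp hmeas hint).const_mul _).mul (by fun_prop)
  have hgreal (t : ℝ) : fhat t = g t * Real.exp (-s * t ^ 2) := by
    have : Complex.exp (s * (t : ℂ) ^ 2) * Complex.exp (-s * (t : ℂ) ^ 2) = 1 := by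
      rw [← Complex.exp_add]; simp
    push_cast
    rw [hg_def, mul_assoc, this, mul_one, hfhat]
  have hgint : Integrable fun t : ℝ => ‖g t‖ ^ q / (1 + |t|) ^ l := by
    refine hii.congr (.of_forall fun t => ?_)
    dsimp only
    rw [hgreal, norm_mul _ (Complex.ofReal _), Complex.norm_real,
      Real.norm_of_nonneg (Real.exp_pos _).le, Real.mul_rpow (norm_nonneg _) (Real.exp_pos _).le, ← Real.exp_mul, mul_assoc,
      ← Real.exp_add, show -s * t ^ 2 * q + q * s * t ^ 2 = 0 by ring, Real.exp_zero, mul_one]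
  have hgrowth (z : ℂ) : ‖g z‖ ≤
      κ * C * (1 + 2 * s) ^ (k / p) * (1 + ‖z‖) ^ ⌈k / p⌉₊ * Real.exp (s * z.re ^ 2) := by
    refine (hg z).trans ?_
    rw [mul_assoc (κ * C) _ ((1 + ‖z‖) ^ _)]
    gcongr
    have h1 : 1 + 2 * s * |z.im| ≤ (1 + 2 * s) * (1 + ‖z‖) := by
      have h2 : 2 * s * |z.im| ≤ 2 * s * ‖z‖ := by
        gcongr; exact Complex.abs_im_le_norm z
      nlinarith [norm_nonneg z]
    calc (1 + 2 * s * |z.im|) ^ (k / p) ≤ ((1 + 2 * s) * (1 + ‖z‖)) ^ (k / p) := by gcongr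
      _ = (1 + 2 * s) ^ (k / p) * (1 + ‖z‖) ^ (k / p) :=
          Real.mul_rpow (by positivity) (by positivity)
      _ ≤ _ := by
          gcongr
          rw [← Real.rpow_natCast]
          exact Real.rpow_le_rpow_of_exponent_le (by linarith [norm_nonneg z]) (Nat.le_ceil _)
  obtain ⟨P, hP⟩ := exists_polynomial_of_integrable_rpow hgdiff hs.le hq (by linarith) hgrowth hgint
  have hdeg1 : (P.natDegree : ℝ) ≤ k / p := by
    refine Polynomial.natDegree_le_of_norm_eval_mul_I_le (C := κ * C) (a := 2 * s)
      (by positivity) hα fun v => ?_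
    simpa [← hP] using hg (v * Complex.I)
  simp only [hP] at hgint hgreal
  have hdeg2 := Polynomial.natDegree_lt_of_integrable_rpow (by linarith) hl hgint
  refine ⟨P, hgreal, le_min (by linarith) hdeg2.le, fun hlq => ?_⟩
  have hdeg0 : P.natDegree = 0 := by
    have : (P.natDegree : ℝ) < 1 := hdeg2.trans_le ((div_le_one (by linarith)).2 (by linarith))
    exact_mod_cast Nat.lt_one_iff.1 (by exact_mod_cast this)
  obtain ⟨c, rfl⟩ := Polynomial.natDegree_eq_zero.1 hdeg0
  simp only [Polynomial.eval_C] at hgreal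
  refine ⟨⟨c, hgreal⟩, ?_⟩
  set γ : ℂ := (π * (4 * s) : ℂ) ^ (1 / 2 : ℂ) with hγ_def
  have hγ : γ ≠ 0 := by
    rw [hγ_def, Complex.cpow_ne_zero_iff]
    left
    exact_mod_cast (by positivity : π * (4 * s) ≠ 0)
  have hκ' : (κ : ℂ) ≠ 0 := by exact_mod_cast hκ.ne'
  refine ⟨c / (κ * γ), ?_⟩
  have hfint : Integrable f :=
    (integrable_norm_iff hmeas).1 (by simpa using hint 0)
  have hgauss : Integrable fun x : ℝ => c / (κ * γ) * (Real.exp (-x ^ 2 / (4 * s)) : ℂ) := by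
    have h : Integrable fun x : ℝ => Real.exp (-x ^ 2 / (4 * s)) := by
      refine (integrable_exp_neg_mul_sq (by positivity : 0 < (4 * s)⁻¹)).congr
        (.of_forall fun x => ?_)
      dsimp only
      congr 1
      ring
    exact h.ofReal.const_mul _
  have hmulexp {φ : ℝ → ℂ} (hφ : Integrable φ) (t : ℝ) :
      Integrable fun x : ℝ => φ x * Complex.exp (-Complex.I * t * x) := by
    refine hφ.mono (hφ.aestronglyMeasurable.mul (by fun_prop)) (.of_forall fun x => ?_)
    simp [Complex.norm_exp]
  have hzero := ae_eq_zero_of_integral_mul_cexp_eq_zero (hfint.sub hgauss) fun t => ?_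
  · filter_upwards [hzero] with x hx using sub_eq_zero.1 hx
  · simp only [Pi.sub_apply, sub_mul]
    rw [integral_sub (hmulexp hfint t) (hmulexp hgauss t)]
    simp only [mul_assoc (c / (κ * γ))]
    rw [integral_const_mul, integral_gaussian_mul_cexp hs t, ← hγ_def]
    have h := (hfhat t).symm.trans (hgreal t)
    rw [sub_eq_zero, ← mul_right_inj' hκ', h]
    field_simp
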